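/- Let G be a finite p-group. If d denotes the number of distinct degrees of nonlinear irreducible complex characters of G, then the derived length of G is at most d + 1. -/

import Mathlib

open CategoryTheory
open scoped Classical

noncomputable section

/-- The set of ordinary irreducible complex characters of `G`. -/
def Irr (G : Type) [Group G] : Set (G → ℂ) :=
  {f | ∃ V : FDRep ℂ G, Simple V ∧ f = V.character}

/-- The degree of a character (its value at the identity). -/
def deg {G : Type} [One G] (f : G → ℂ) : ℕ := ⌊(f 1).re⌋₊

open Module Representation

section Monomial

variable {G V : Type} [Group G] [AddCommGroup V] [Module ℂ V]

/-- A representation is monomial if it has a basis whose lines are permuted by the group. -/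
def IsMonomial (ρ : Representation ℂ G V) : Prop :=
  ∃ (ι : Type) (b : Basis ι ℂ V), ∀ g i, ∃ j, ∃ c : ℂ, ρ g (b i) = c • b j

lemma representation_injective (ρ : Representation ℂ G V) (g : G) : Function.Injective (ρ g) :=
  fun x y hxy => by simpa using congrArg (ρ g⁻¹) hxy

lemma apply_mem_map_iff (ρ : Representation ℂ G V) (g : G) (W : Submodule ℂ V) (v : V) :
    ρ g v ∈ W.map (ρ g) ↔ v ∈ W := by
  simp [Submodule.mem_map, (representation_injective ρ g).eq_iff]

/-- The subgroup of elements acting by scalars. -/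
def scalarSubgroup (ρ : Representation ℂ G V) : Subgroup G where
  carrier := {g | ∃ c : ℂˣ, ∀ v, ρ g v = c • v}
  one_mem' := ⟨1, by simp⟩
  mul_mem' := by
    rintro a b ⟨c, hc⟩ ⟨d, hd⟩
    exact ⟨c * d, fun v => by simp [hc, hd, mul_smul]⟩
  inv_mem' := by
    rintro a ⟨c, hc⟩
    refine ⟨c⁻¹, fun v => ?_⟩
    rw [eq_inv_smul_iff, ← hc, ρ.self_inv_apply]

instance scalarSubgroup_normal (ρ : Representation ℂ G V) : (scalarSubgroup ρ).Normal where
  conj_mem := by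
    rintro n ⟨c, hc⟩ g
    refine ⟨c, fun v => ?_⟩
    simp [hc, Units.smul_def]

lemma exists_conj_eq_smul_of_ne_top [Finite G] {p : ℕ} [Fact p.Prime] (hG : IsPGroup p G)
    (ρ : Representation ℂ G V) (h : scalarSubgroup ρ ≠ ⊤) :
    ∃ a, a ∉ scalarSubgroup ρ ∧ ∀ g, ∃ c : ℂˣ, ∀ v, ρ (g⁻¹ * a * g) v = c • ρ a v := by
  have : Nontrivial (G ⧸ scalarSubgroup ρ) := by
    rwa [QuotientGroup.nontrivial_iff]
  have := (hG.to_quotient (scalarSubgroup ρ)).center_nontrivial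
  obtain ⟨⟨x, hx⟩, hx1⟩ := exists_ne (1 : Subgroup.center (G ⧸ scalarSubgroup ρ))
  obtain ⟨a, rfl⟩ := QuotientGroup.mk_surjective x
  refine ⟨a, fun ha => hx1 (Subtype.ext ((QuotientGroup.eq_one_iff a).mpr ha)), fun g => ?_⟩
  have hg : ((a * g : G) : G ⧸ scalarSubgroup ρ) = (g * a : G) :=
    (Subgroup.mem_center_iff.mp hx (g : G ⧸ scalarSubgroup ρ)).symm
  have hmem : a⁻¹ * (g⁻¹ * a * g) ∈ scalarSubgroup ρ := by
    have := QuotientGroup.eq.mp hg.symm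
    simpa [mul_assoc] using this
  obtain ⟨c, hc⟩ := hmem
  refine ⟨c, fun v => ?_⟩
  have : g⁻¹ * a * g = a * (a⁻¹ * (g⁻¹ * a * g)) := by group
  rw [this, map_mul, Module.End.mul_apply, hc, Units.smul_def, map_smul, Units.smul_def]

lemma isMonomial_of_blocks (ρ : Representation ℂ G V) (s : Set (Submodule ℂ V))
    (hind : sSupIndep s) (htop : sSup s = ⊤) (hs : ∀ g, ∀ W ∈ s, W.map (ρ g) ∈ s)
    (hm : ∀ W ∈ s, ∃ (ι : Type) (b : Basis ι ℂ W), ∀ g, W.map (ρ g) = W →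
      ∀ i, ∃ j, ∃ c : ℂ, ρ g (b i) = c • (b j : V)) :
    IsMonomial ρ := by
  have map_mul_eq (g h : G) (W : Submodule ℂ V) :
      W.map (ρ (g * h)) = (W.map (ρ h)).map (ρ g) := by
    rw [map_mul, Module.End.mul_eq_comp, Submodule.map_comp]
  have map_one_eq (W : Submodule ℂ V) : W.map (ρ 1) = W := by
    rw [map_one, Module.End.one_eq_id, Submodule.map_id]
  have map_inv_eq {g : G} {W W' : Submodule ℂ V} (h : W.map (ρ g) = W') :
      W'.map (ρ g⁻¹) = W := by
    rw [← h, ← map_mul_eq, inv_mul_cancel, map_one_eq]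
  let rel : Setoid s :=
    { r := fun W W' => ∃ g, W.1.map (ρ g) = W'.1
      iseqv :=
        { refl := fun W => ⟨1, map_one_eq _⟩
          symm := fun ⟨g, hg⟩ => ⟨g⁻¹, map_inv_eq hg⟩
          trans := fun ⟨g, hg⟩ ⟨h, hh⟩ => ⟨h * g, by rw [map_mul_eq, hg, hh]⟩ } }
  let r : s → s := fun W => (Quotient.mk rel W).out
  have hr (W W' : s) (h : ∃ g, W.1.map (ρ g) = W'.1) : r W = r W' :=
    congrArg Quotient.out (Quotient.sound (s := rel) h)
  have ht (W : s) : ∃ g, (r W).1.map (ρ g) = W.1 := Quotient.mk_out (s := rel) W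
  choose t ht using ht
  choose ι b hb using hm
  let B : ∀ W : s, Basis (ι (r W).1 (r W).2) ℂ W.1 := fun W =>
    (b (r W).1 (r W).2).map
      ((Submodule.equivMapOfInjective (ρ (t W)) (representation_injective ρ _) (r W).1).trans (LinearEquiv.ofEq _ _ (ht W)))
  have hB (W : s) (i) : (B W i : V) = ρ (t W) (b (r W).1 (r W).2 i) := by
    simp [B]
  have hint : DirectSum.IsInternal (fun W : s => W.1) :=
    DirectSum.isInternal_submodule_of_iSupIndep_of_iSup_eq_top ((sSupIndep_iff s).mp hind)
      (by rw [← sSup_eq_iSup', htop])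
  have key (R R' : s) (hR : R = R') (h : G) (hh : R.1.map (ρ h) = R'.1) (i : ι R.1 R.2) :
      ∃ j : ι R'.1 R'.2, ∃ c : ℂ, ρ h (b R.1 R.2 i) = c • (b R'.1 R'.2 j : V) := by
    subst hR
    exact hb R.1 R.2 h hh i
  refine ⟨_, hint.collectedBasis B, ?_⟩
  rintro g ⟨W, i⟩
  let W' : s := ⟨W.1.map (ρ g), hs g W.1 W.2⟩
  obtain ⟨j, c, hj⟩ := key (r W) (r W') (hr _ _ ⟨g, rfl⟩) ((t W')⁻¹ * (g * t W))
    (by rw [map_mul_eq, map_mul_eq, ht W]; exact map_inv_eq (ht W')) i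
  refine ⟨⟨W', j⟩, c, ?_⟩
  rw [DirectSum.IsInternal.collectedBasis_coe]
  simp only [hB]
  rw [← map_smul, ← hj, ← Module.End.mul_apply, ← Module.End.mul_apply, ← map_mul, ← map_mul,
    mul_inv_cancel_left]

lemma map_eigenspace_eq (ρ : Representation ℂ G V) {a g : G} {c : ℂˣ}
    (h : ∀ v, ρ (g⁻¹ * a * g) v = c • ρ a v) (μ : ℂ) :
    (End.eigenspace (ρ a) μ).map (ρ g) = End.eigenspace (ρ a) (c * μ) := by
  have hcomm (v : V) : ρ a (ρ g v) = (c : ℂ) • ρ g (ρ a v) := by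
    rw [← map_smul, ← Units.smul_def, ← h, ← Module.End.mul_apply, ← Module.End.mul_apply,
      ← map_mul, ← map_mul]
    congr 2
    group
  ext w
  obtain ⟨v, rfl⟩ : ∃ v, ρ g v = w := ⟨ρ g⁻¹ w, by simp⟩
  rw [apply_mem_map_iff, End.mem_eigenspace_iff, End.mem_eigenspace_iff, hcomm,
    mul_smul, ← map_smul (ρ g) μ, (smul_right_injective V c.ne_zero).eq_iff,
    (representation_injective ρ g).eq_iff]

lemma iSup_eigenspace_eq_top [Finite G] [FiniteDimensional ℂ V] (ρ : Representation ℂ G V)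
    (a : G) : ⨆ μ, End.eigenspace (ρ a) μ = ⊤ := by
  have h : End.IsSemisimple (ρ a) := by
    refine Module.End.isSemisimple_of_squarefree_aeval_eq_zero
      (p := Polynomial.X ^ Nat.card G - 1) ?_ ?_
    · exact (Polynomial.X_pow_sub_one_separable_iff.mpr
        (Nat.cast_ne_zero.mpr Nat.card_pos.ne')).squarefree
    · rw [map_sub, map_pow, Polynomial.aeval_X, map_one, ← map_pow ρ, pow_card_eq_one', map_one,
        sub_self]
  exact h.iSup_eigenspace_eq_top

theorem isMonomial_of_isPGroup {p : ℕ} [Fact p.Prime] (n : ℕ) :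
    ∀ {G V : Type} [Group G] [Finite G] [AddCommGroup V] [Module ℂ V] [FiniteDimensional ℂ V]
      (_ : IsPGroup p G) (ρ : Representation ℂ G V) (_ : finrank ℂ V = n), IsMonomial ρ := by
  induction n using Nat.strong_induction_on with
  | _ n ih =>
  intro G V _ _ _ _ _ hG ρ hn
  by_cases hS : scalarSubgroup ρ = ⊤
  · refine ⟨_, Basis.ofVectorSpace ℂ V, fun g i => ?_⟩
    obtain ⟨c, hc⟩ : g ∈ scalarSubgroup ρ := hS ▸ Subgroup.mem_top g
    exact ⟨i, c, hc _⟩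
  obtain ⟨a, ha, hconj⟩ := exists_conj_eq_smul_of_ne_top hG ρ hS
  refine isMonomial_of_blocks ρ (Set.range (End.eigenspace (ρ a)))
    (End.eigenspaces_iSupIndep _).sSupIndep_range ?_ ?_ ?_
  · rw [sSup_range, iSup_eigenspace_eq_top]
  · rintro g _ ⟨μ, rfl⟩
    obtain ⟨c, hc⟩ := hconj g
    exact ⟨c * μ, (map_eigenspace_eq ρ hc μ).symm⟩
  rintro W ⟨μ, hW⟩
  have hlt : finrank ℂ W < n := by
    rw [← hn]
    refine Submodule.finrank_lt fun htop => ha ?_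
    have hv (v : V) : ρ a v = μ • v := by
      rw [← End.mem_eigenspace_iff, hW, htop]
      trivial
    by_cases hμ : μ = 0
    · refine ⟨1, fun v => ?_⟩
      have hz (w : V) : w = 0 := by
        simpa [hμ] using hv (ρ a⁻¹ w)
      rw [hz v, map_zero, smul_zero]
    · exact ⟨Units.mk0 μ hμ, hv⟩
  let H : Subgroup G :=
    { carrier := {g | ∀ v, ρ g v ∈ W ↔ v ∈ W}
      one_mem' := by simp
      mul_mem' := fun {g h} hg hh v => by
        rw [map_mul, Module.End.mul_apply, hg, hh]
      inv_mem' := fun {g} hg v => by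
        rw [← hg, ρ.self_inv_apply] }
  let σ : Subrepresentation (ρ.comp H.subtype) :=
    ⟨W, fun g v hv => (g.2 v).mpr hv⟩
  obtain ⟨ι, b, hb⟩ := ih _ hlt (hG.to_subgroup H) σ.toRepresentation rfl
  refine ⟨ι, b, fun g hg i => ?_⟩
  have hgH : g ∈ H := fun v => by
    nth_rw 1 [← hg]
    exact apply_mem_map_iff ρ g W v
  obtain ⟨j, c, hj⟩ := hb ⟨g, hgH⟩ i
  exact ⟨j, c, congrArg Subtype.val hj⟩

end Monomial

section Taketa

variable {G : Type} [Group G]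

/-- The permutation representation on functions. -/
def functionRep (G X : Type) [Group G] [MulAction G X] : Representation ℂ G (X → ℂ) where
  toFun g := LinearMap.funLeft ℂ ℂ (fun x => g⁻¹ • x)
  map_one' := by ext; simp [LinearMap.funLeft]
  map_mul' g h := by
    refine LinearMap.ext fun f => funext fun x => ?_
    simp [LinearMap.funLeft, mul_smul]

lemma functionRep_apply {X : Type} [MulAction G X] (g : G) (f : X → ℂ) (x : X) :
    functionRep G X g f x = f (g⁻¹ • x) := rfl

lemma smul_eq_of_functionRep_eq_one {X : Type} [MulAction G X] {g : G}
    (h : functionRep G X g = 1) (x : X) : g • x = x := by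
  have := congrFun (LinearMap.congr_fun h (Pi.single x 1)) (g • x)
  rw [functionRep_apply, inv_smul_smul, Module.End.one_apply, Pi.single_eq_same] at this
  by_contra hne
  rw [Pi.single_eq_of_ne hne] at this
  exact one_ne_zero this

/-- The span of the constant functions. -/
def constantSubrep (G X : Type) [Group G] [MulAction G X] : Subrepresentation (functionRep G X) where
  toSubmodule := Submodule.span ℂ {fun _ => 1}
  apply_mem_toSubmodule g v hv := by
    obtain ⟨c, rfl⟩ := Submodule.mem_span_singleton.mp hv
    exact Submodule.mem_span_singleton.mpr ⟨c, rfl⟩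

lemma finrank_constantSubrep_le (X : Type) [MulAction G X] :
    finrank ℂ (constantSubrep G X).toSubmodule ≤ 1 :=
  (finrank_span_le_card _).trans (by simp)

lemma not_isIrreducible_functionRep {X : Type} [MulAction G X] [Fintype X]
    (hX : 1 < Fintype.card X) : ¬ IsIrreducible (functionRep G X) := by
  intro h
  have : Nonempty X := Fintype.card_pos_iff.mp (by lia)
  rcases h.eq_bot_or_eq_top (constantSubrep G X) with h | h
  · have h1 : (fun _ => 1 : X → ℂ) ∈ (constantSubrep G X).toSubmodule :=
      Submodule.mem_span_singleton_self _
    rw [h] at h1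
    exact one_ne_zero (congrFun ((Submodule.mem_bot ℂ).mp h1) (Classical.arbitrary X))
  · have h1 := finrank_constantSubrep_le (G := G) X
    rw [h] at h1
    have h2 : finrank ℂ (⊤ : Submodule ℂ (X → ℂ)) ≤ 1 := h1
    rw [finrank_top, finrank_fintype_fun_eq_card] at h2
    lia

lemma apply_eq_one_of_not_isIrreducible [Finite G] {V : Type} [AddCommGroup V] [Module ℂ V]
    [FiniteDimensional ℂ V] {g : G}
    (h : ∀ (W : Type) [AddCommGroup W] [Module ℂ W] [FiniteDimensional ℂ W]
      (σ : Representation ℂ G W), finrank ℂ W < finrank ℂ V → σ g = 1)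
    (ρ : Representation ℂ G V) (hρ : ¬ IsIrreducible ρ) : ρ g = 1 := by
  have hlt (P : Subrepresentation ρ) (hP : P ≠ ⊤) (v : V) (hv : v ∈ P.toSubmodule) :
      ρ g v = v := by
    have hfr : finrank ℂ P.toSubmodule < finrank ℂ V :=
      Submodule.finrank_lt fun htop => hP (Subrepresentation.toSubmodule_injective htop)
    exact congrArg Subtype.val (LinearMap.congr_fun (h _ P.toRepresentation hfr) ⟨v, hv⟩)
  rcases subsingleton_or_nontrivial V with hV | hV
  · exact LinearMap.ext fun v => Subsingleton.elim _ _
  have hbt : (⊥ : Subrepresentation ρ) ≠ ⊤ := fun hbt =>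
    bot_ne_top (congrArg Subrepresentation.toSubmodule hbt)
  obtain ⟨P, hP0, hP1⟩ : ∃ P : Subrepresentation ρ, P ≠ ⊥ ∧ P ≠ ⊤ := by
    by_contra! hcon
    exact hρ
      { exists_pair_ne := ⟨⊥, ⊤, hbt⟩
        eq_bot_or_eq_top := fun P => or_iff_not_imp_left.mpr (hcon P) }
  obtain ⟨Q, hQ⟩ := exists_isCompl P
  have hQ1 : Q ≠ ⊤ := fun hQ1 => hP0 (eq_bot_of_isCompl_top (hQ1 ▸ hQ))
  refine LinearMap.ext fun v => ?_
  have hv : v ∈ P.toSubmodule ⊔ Q.toSubmodule := by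
    rw [← Subrepresentation.toSubmodule_sup, hQ.sup_eq_top]
    trivial
  obtain ⟨x, hx, y, hy, rfl⟩ := Submodule.mem_sup.mp hv
  rw [map_add, hlt P hP1 x hx, hlt Q hQ1 y hy, Module.End.one_apply]

lemma exists_mulAction_of_basis {ι V : Type} [AddCommGroup V] [Module ℂ V]
    (ρ : Representation ℂ G V) (b : Basis ι ℂ V)
    (h : ∀ g i, ∃ j, ∃ c : ℂ, ρ g (b i) = c • b j) :
    ∃ _ : MulAction G ι, ∀ (g : G) i, ∃ c : ℂ, ρ g (b i) = c • b (g • i) := by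
  choose σ c hσ using h
  have huniq {i j k : ι} {g : G} {d e : ℂ} (hj : ρ g (b i) = d • b j) (hk : ρ g (b i) = e • b k) :
      j = k := by
    have hd : d ≠ 0 := by
      rintro rfl
      rw [zero_smul] at hj
      exact b.ne_zero i (representation_injective ρ g (hj.trans (map_zero _).symm))
    by_contra hjk
    have := congrArg (fun v => b.repr v j) (hj.symm.trans hk)
    simp [Ne.symm hjk, hd] at this
  have one_smul (i : ι) : σ 1 i = i := huniq (hσ 1 i) (e := 1) (by simp)
  have mul_smul (g h : G) (i : ι) : σ (g * h) i = σ g (σ h i) := by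
    refine huniq (hσ (g * h) i) (e := c h i * c g (σ h i)) ?_
    rw [map_mul, Module.End.mul_apply, hσ h i, map_smul, hσ g, smul_smul]
  exact ⟨{ smul := σ, one_smul := one_smul, mul_smul := mul_smul }, fun g i => ⟨c g i, hσ g i⟩⟩

lemma apply_eq_one_of_mem_commutator {V : Type} [AddCommGroup V] [Module ℂ V]
    (ρ : Representation ℂ G V) {N : Subgroup G}
    (hN : ∀ g ∈ N, ∀ h ∈ N, ρ g * ρ h = ρ h * ρ g) {g : G} (hg : g ∈ ⁅N, N⁆) : ρ g = 1 := by
  have hle : ⁅N, N⁆ ≤ ρ.ker := by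
    rw [Subgroup.commutator_le]
    intro x hx y hy
    rw [MonoidHom.mem_ker, commutatorElement_def, map_mul, map_mul, map_mul, hN x hx y hy,
      mul_assoc (ρ y), ← map_mul ρ x, mul_inv_cancel, map_one, mul_one, ← map_mul, mul_inv_cancel,
      map_one]
  exact hle hg

/-- The set of degrees of nonlinear irreducible characters. -/
def nonlinearDegrees (G : Type) [Group G] : Set ℕ := {n | ∃ χ ∈ Irr G, deg χ = n ∧ 1 < n}

lemma deg_character (V : FDRep ℂ G) : deg V.character = finrank ℂ V := by
  simp [deg, FDRep.char_one]

lemma finite_Irr [Fintype G] : (Irr G).Finite := by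
  have : Invertible (Nat.card G : ℂ) :=
    invertibleOfNonzero (Nat.cast_ne_zero.mpr Nat.card_pos.ne')
  let L : (G → ℂ) → Dual ℂ (G → ℂ) := fun ψ =>
    (Nat.card G : ℂ)⁻¹ • ∑ g : G, ψ g⁻¹ • LinearMap.proj g
  have hL (φ ψ : G → ℂ) : L ψ φ = (Nat.card G : ℂ)⁻¹ * ∑ g : G, φ g * ψ g⁻¹ := by
    simp [L, mul_comm]
  have hli : LinearIndependent ℂ (fun χ : Irr G => (χ : G → ℂ)) := by
    refine LinearIndependent.of_pairwise_dual_eq_zero_one _ (fun χ => L χ) ?_ ?_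
    · rintro ⟨_, V, hV, rfl⟩ ⟨_, W, hW, rfl⟩ hne
      rw [hL, FDRep.char_orthonormal, if_neg]
      rintro ⟨e⟩
      exact hne (Subtype.ext (FDRep.char_iso e).symm)
    · rintro ⟨_, V, hV, rfl⟩
      rw [hL, FDRep.char_orthonormal, if_pos ⟨Iso.refl _⟩]
  exact hli.setFinite

lemma finite_nonlinearDegrees [Fintype G] : (nonlinearDegrees G).Finite := by
  refine ((finite_Irr (G := G)).image deg).subset ?_
  rintro n ⟨χ, hχ, h, -⟩
  exact ⟨χ, hχ, h⟩

lemma finrank_mem_nonlinearDegrees [Fintype G] {V : Type} [AddCommGroup V] [Module ℂ V]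
    [FiniteDimensional ℂ V] (ρ : Representation ℂ G V) [IsIrreducible ρ]
    (hV : 1 < finrank ℂ V) : finrank ℂ V ∈ nonlinearDegrees G := by
  have : Invertible (Nat.card G : ℂ) :=
    invertibleOfNonzero (Nat.cast_ne_zero.mpr Nat.card_pos.ne')
  have hsimple : Simple (FDRep.of ρ) := by
    rw [FDRep.simple_iff_char_is_norm_one]
    have h := Representation.char_orthonormal ρ ρ
    rw [if_pos ⟨Representation.Equiv.refl ρ⟩, inv_mul_eq_one₀ (Nat.cast_ne_zero.mpr Nat.card_pos.ne')] at h
    exact h.symm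
  exact ⟨_, ⟨FDRep.of ρ, hsimple, rfl⟩, deg_character _, hV⟩

theorem apply_eq_one_of_mem_derivedSeries [Fintype G] {p : ℕ} [Fact p.Prime] (hG : IsPGroup p G)
    (n : ℕ) : ∀ (V : Type) [AddCommGroup V] [Module ℂ V] [FiniteDimensional ℂ V]
      (ρ : Representation ℂ G V), finrank ℂ V ≤ n →
      ∀ g ∈ derivedSeries G ((nonlinearDegrees G ∩ Set.Iic n).ncard + 1), ρ g = 1 := by
  induction n with
  | zero =>
    intro V _ _ _ ρ hV g _
    have : Subsingleton V := finrank_zero_iff.mp (Nat.le_zero.mp hV)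
    exact LinearMap.ext fun v => Subsingleton.elim _ _
  | succ n ih =>
    intro V _ _ _ ρ hV g hg
    have hfin := (finite_nonlinearDegrees (G := G)).inter_of_left (Set.Iic (n + 1))
    have hsub : nonlinearDegrees G ∩ Set.Iic n ⊆ nonlinearDegrees G ∩ Set.Iic (n + 1) :=
      Set.inter_subset_inter_right _ (Set.Iic_subset_Iic.mpr n.le_succ)
    have hg' : g ∈ derivedSeries G ((nonlinearDegrees G ∩ Set.Iic n).ncard + 1) :=
      derivedSeries_antitone G (Nat.succ_le_succ (Set.ncard_le_ncard hsub hfin)) hg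
    rcases hV.lt_or_eq with hlt | hV
    · exact ih V ρ (Nat.lt_succ_iff.mp hlt) g hg'
    by_cases hρ : IsIrreducible ρ
    swap
    · exact apply_eq_one_of_not_isIrreducible
        (fun W _ _ _ σ hW => ih W σ (by lia) g hg') ρ hρ
    rcases Nat.eq_zero_or_pos n with rfl | hn
    · refine apply_eq_one_of_mem_commutator ρ (N := ⊤) (fun x _ y _ => ?_)
        (derivedSeries_antitone G (Nat.le_add_left 1 _) hg)
      obtain ⟨v, -, hv⟩ := finrank_eq_one_iff'.mp hV
      obtain ⟨c, hc⟩ := hv (ρ x v)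
      obtain ⟨d, hd⟩ := hv (ρ y v)
      refine LinearMap.ext fun w => ?_
      obtain ⟨e, rfl⟩ := hv w
      simp [← hc, ← hd, smul_comm c d]
    have hmem : n + 1 ∈ nonlinearDegrees G :=
      hV ▸ finrank_mem_nonlinearDegrees ρ (by lia)
    have hlt : (nonlinearDegrees G ∩ Set.Iic n).ncard + 1 ≤
        (nonlinearDegrees G ∩ Set.Iic (n + 1)).ncard := by
      refine Set.ncard_lt_ncard ⟨hsub, fun h => ?_⟩ hfin
      have := (h ⟨hmem, Set.self_mem_Iic⟩).2
      simp at this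
    obtain ⟨ι, b, hb⟩ := isMonomial_of_isPGroup _ hG ρ rfl
    obtain ⟨_, hact⟩ := exists_mulAction_of_basis ρ b hb
    have : Fintype ι := FiniteDimensional.fintypeBasisIndex b
    have hcard : Fintype.card ι = n + 1 := by rw [← finrank_eq_card_basis b, hV]
    have hdiag : ∀ x ∈ derivedSeries G ((nonlinearDegrees G ∩ Set.Iic n).ncard + 1),
        ∀ i, ∃ c : ℂ, ρ x (b i) = c • b i := by
      intro x hx i
      have h1 : functionRep G ι x = 1 := by
        refine apply_eq_one_of_not_isIrreducible (fun W _ _ _ σ hW => ih W σ ?_ x hx) _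
          (not_isIrreducible_functionRep (by lia))
        rw [finrank_fintype_fun_eq_card] at hW
        lia
      obtain ⟨c, hc⟩ := hact x i
      exact ⟨c, by rwa [smul_eq_of_functionRep_eq_one h1] at hc⟩
    refine apply_eq_one_of_mem_commutator ρ (fun x hx y hy => b.ext fun i => ?_)
      (derivedSeries_antitone G (Nat.succ_le_succ hlt) hg)
    obtain ⟨c, hc⟩ := hdiag x hx i
    obtain ⟨d, hd⟩ := hdiag y hy i
    simp [hc, hd, smul_comm c d]

end Taketa

/-- Taketa-type bound for finite `p`-groups: if `d` is the number of distinct degrees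
of nonlinear irreducible complex characters of a finite `p`-group `G`, then the derived
length of `G` is at most `d + 1`. -/
theorem stmt11 (p : ℕ) [Fact p.Prime] {G : Type} [Group G] [Fintype G]
    (hG : IsPGroup p G) (d : ℕ)
    (hd : d = Set.ncard {n : ℕ | ∃ χ ∈ Irr G, deg χ = n ∧ 1 < n}) :
    derivedSeries G (d + 1) = ⊥ := by
  rw [eq_bot_iff]
  intro g hg
  have hle : (nonlinearDegrees G ∩ Set.Iic (Fintype.card G)).ncard ≤ d :=
    hd ▸ Set.ncard_le_ncard Set.inter_subset_left finite_nonlinearDegrees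
  have h := apply_eq_one_of_mem_derivedSeries hG _ _ (functionRep G G)
    (finrank_fintype_fun_eq_card ℂ).le g (derivedSeries_antitone G (Nat.succ_le_succ hle) hg)
  simpa using smul_eq_of_functionRep_eq_one h 1
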